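/- For α ∈ 𝔻 with α ≠ 0 and a ∈ (0,1), the reproducing kernel κ_α(z) = 1/(1 - conj(α)z) is a cyclic vector for C_{φ_a} on H²(𝔻): the closed linear span of {κ_α ∘ φ_{a^n} : n ≥ 0} is all of H²(𝔻). -/

import Mathlib

open Complex Metric Filter

noncomputable def hardyCoeff (f : ℂ → ℂ) (n : ℕ) : ℂ := iteratedDeriv n f 0 / n.factorial

/-- `f` belongs to the Hardy space `H²(𝔻)`. -/
def MemH2 (f : ℂ → ℂ) : Prop :=
  AnalyticOnNhd ℂ f (ball (0:ℂ) 1) ∧ Summable (fun n => ‖hardyCoeff f n‖ ^ 2)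

/-- The `H²` norm of `f`, computed from Taylor coefficients. -/
noncomputable def h2Norm (f : ℂ → ℂ) : ℝ := Real.sqrt (∑' n, ‖hardyCoeff f n‖ ^ 2)

/-- The  inner product. -/
noncomputable def h2Inner (f g : ℂ → ℂ) : ℂ :=
  ∑' n, hardyCoeff f n * (starRingEnd ℂ) (hardyCoeff g n)

lemma aux_coeff {g : ℂ → ℂ} {c : ℕ → ℂ}
    (h : ∀ᶠ z in nhds (0:ℂ), HasSum (fun m => z ^ m * c m) (g z)) :
    AnalyticAt ℂ g 0 ∧ ∀ m, hardyCoeff g m = c m := by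
  have hp : HasFPowerSeriesAt g (FormalMultilinearSeries.ofScalars ℂ c) 0 := by
    rw [hasFPowerSeriesAt_iff]
    filter_upwards [h] with z hz
    simpa [FormalMultilinearSeries.coeff_ofScalars] using hz
  refine ⟨hp.analyticAt, fun m => ?_⟩
  have h2 := hp.analyticAt.hasFPowerSeriesAt
  have h3 := congrArg (fun p => FormalMultilinearSeries.coeff p m)
    (hp.eq_formalMultilinearSeries h2)
  simp only [FormalMultilinearSeries.coeff_ofScalars] at h3
  exact h3.symm

lemma aux_kernel (c w : ℂ) {g : ℂ → ℂ}
    (h : ∀ᶠ z in nhds (0:ℂ), g z = c * (1 - w * z)⁻¹) :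
    AnalyticAt ℂ g 0 ∧ ∀ m, hardyCoeff g m = c * w ^ m := by
  apply aux_coeff
  have h1 : ∀ᶠ z in nhds (0:ℂ), ‖w * z‖ < 1 := by
    have : ContinuousAt (fun z : ℂ => ‖w * z‖) 0 := by fun_prop
    exact this.eventually_lt_const (by simp)
  filter_upwards [h, h1] with z hz hz1
  rw [hz]
  have := (hasSum_geometric_of_norm_lt_one hz1).mul_left c
  refine this.congr_fun ?_ |> fun h => h
  intro m
  rw [mul_pow]; ring

lemma aux_zero {x : ℕ → ℂ} {C : ℝ} (hC : ∀ m, ‖x m‖ ≤ C) (w : ℕ → ℂ)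
    (hw0 : ∀ n, w n ≠ 0) (hw : Tendsto w atTop (nhds 0))
    (hs : ∀ n, HasSum (fun m => w n ^ m * x m) 0) : ∀ m, x m = 0 := by
  set F : ℂ → ℂ := fun z => ∑' m, z ^ m * x m with hF
  have hev : ∀ᶠ z in nhds (0:ℂ), HasSum (fun m => z ^ m * x m) (F z) := by
    filter_upwards [Metric.ball_mem_nhds (0:ℂ) one_pos] with z hz
    have hz : ‖z‖ < 1 := by simpa using hz
    refine Summable.hasSum ?_
    refine Summable.of_norm_bounded
      ((summable_geometric_of_lt_one (norm_nonneg z) hz).mul_right C) fun m => ?_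
    rw [norm_mul, norm_pow]
    exact mul_le_mul_of_nonneg_left (hC m) (by positivity)
  obtain ⟨hA, hc⟩ := aux_coeff hev
  have hfr : ∃ᶠ z in nhdsWithin (0:ℂ) {0}ᶜ, F z = 0 := by
    have ht : Tendsto w atTop (nhdsWithin (0:ℂ) {0}ᶜ) :=
      tendsto_nhdsWithin_iff.2 ⟨hw, Eventually.of_forall fun n => hw0 n⟩
    exact ht.frequently (Frequently.of_forall fun n => (hs n).tsum_eq)
  have h0 := hA.frequently_zero_iff_eventually_zero.1 hfr
  have h4 := (aux_coeff (g := F) (c := fun _ => 0)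
    (by filter_upwards [h0] with z hz; simp [hz])).2
  intro m
  rw [← hc m, h4 m]

lemma aux_sub {f g : ℂ → ℂ} (hf : AnalyticAt ℂ f 0) (hg : AnalyticAt ℂ g 0) (m : ℕ) :
    hardyCoeff (f - g) m = hardyCoeff f m - hardyCoeff g m := by
  unfold hardyCoeff
  rw [iteratedDeriv_sub hf.contDiffAt hg.contDiffAt, sub_div]

lemma aux_add {f g : ℂ → ℂ} (hf : AnalyticAt ℂ f 0) (hg : AnalyticAt ℂ g 0) (m : ℕ) :
    hardyCoeff (f + g) m = hardyCoeff f m + hardyCoeff g m := by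
  unfold hardyCoeff
  rw [iteratedDeriv_add hf.contDiffAt hg.contDiffAt, add_div]

lemma aux_smul {f : ℂ → ℂ} (c : ℂ) (hf : AnalyticAt ℂ f 0) (m : ℕ) :
    hardyCoeff (c • f) m = c * hardyCoeff f m := by
  unfold hardyCoeff
  rw [iteratedDeriv_const_smul hf.contDiffAt c, smul_eq_mul, mul_div_assoc]

theorem kernel_is_cyclic (a : ℝ) (ha : a ∈ Set.Ioo (0:ℝ) 1) (α : ℂ) (hα : α ∈ ball (0:ℂ) 1)
    (hα0 : α ≠ 0) :
    ∀ f : ℂ → ℂ, MemH2 f → ∀ ε > 0,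
      ∃ g ∈ Submodule.span ℂ {h : ℂ → ℂ | ∃ n : ℕ,
          h = fun z => 1 / (1 - (starRingEnd ℂ) α * ((a:ℂ)^n * z + 1 - (a:ℂ)^n))},
        h2Norm (f - g) < ε := by
  intro f hf ε hε
  set T : Set (ℂ → ℂ) := {h : ℂ → ℂ | ∃ n : ℕ,
          h = fun z => 1 / (1 - (starRingEnd ℂ) α * ((a:ℂ)^n * z + 1 - (a:ℂ)^n))} with hT
  obtain ⟨ha0, ha1⟩ := ha
  set β := (starRingEnd ℂ) α with hβ
  have hβ1 : ‖β‖ < 1 := by simpa [hβ] using hα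
  have hβ0 : β ≠ 0 := by simpa [hβ] using hα0
  have han : ∀ n : ℕ, (a:ℂ)^n ≠ 0 := fun n => pow_ne_zero _ (by exact_mod_cast ha0.ne')
  set d : ℕ → ℂ := fun n => 1 - β * (1 - (a:ℂ)^n) with hd
  set w : ℕ → ℂ := fun n => β * (a:ℂ)^n / d n with hw
  have hlt : ∀ n, ‖β * (a:ℂ)^n‖ < ‖d n‖ := by
    intro n
    have e1 : ‖(a:ℂ)^n‖ = a^n := by simp [abs_of_pos ha0]
    have e2 : ‖1 - (a:ℂ)^n‖ = 1 - a^n := by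
      have : (1 - (a:ℂ)^n) = ((1 - a^n : ℝ) : ℂ) := by push_cast; rfl
      rw [this, Complex.norm_real, Real.norm_eq_abs, abs_of_nonneg]
      linarith [pow_le_one₀ (n := n) ha0.le ha1.le]
    have e3 := norm_sub_norm_le (1:ℂ) (β * (1 - (a:ℂ)^n))
    rw [norm_mul, e2, norm_one] at e3
    rw [norm_mul, e1]
    simp only [hd]
    nlinarith
  have hd0 : ∀ n, d n ≠ 0 := fun n => norm_pos_iff.1 ((norm_nonneg _).trans_lt (hlt n))
  have hw1 : ∀ n, ‖w n‖ < 1 := fun n => by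
    simp only [hw]
    rw [norm_div, div_lt_one (norm_pos_iff.2 (hd0 n))]; exact hlt n
  have hw0 : ∀ n, w n ≠ 0 := fun n => div_ne_zero (mul_ne_zero hβ0 (han n)) (hd0 n)
  have hat : Tendsto (fun n : ℕ => (a:ℂ)^n) atTop (nhds 0) :=
    tendsto_pow_atTop_nhds_zero_of_norm_lt_one (by simpa [abs_of_pos ha0] using ha1)
  have h1β : 1 - β ≠ 0 := by
    intro h
    rw [← sub_eq_zero.1 h] at hβ1
    simp at hβ1
  have hwt : Tendsto w atTop (nhds 0) := by
    have h1 : Tendsto d atTop (nhds (1 - β * (1 - 0))) :=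
      tendsto_const_nhds.sub ((tendsto_const_nhds.sub hat).const_mul β)
    have h2 := (hat.const_mul β).div h1 (by simpa using h1β)
    rw [mul_zero, zero_div] at h2
    exact h2
  have hmem : ∀ n, Memℓp (fun m => w n ^ m : ℕ → ℂ) 2 := by
    intro n
    apply memℓp_gen
    have : ∀ m : ℕ, ‖w n ^ m‖ ^ (2 : ENNReal).toReal = (‖w n‖ ^ 2) ^ m := by
      intro m
      rw [norm_pow]; simp; ring
    simp_rw [this]
    apply summable_geometric_of_lt_one (by positivity)
    have := hw1 n
    nlinarith [norm_nonneg (w n)]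
  let k : ℕ → lp (fun _ : ℕ => ℂ) 2 := fun n => ⟨_, hmem n⟩
  have hk : ∀ n m, (k n) m = w n ^ m := fun n m => rfl
  set S := Submodule.span ℂ (Set.range k) with hS
  have hSd : S.topologicalClosure = ⊤ := by
    rw [Submodule.topologicalClosure_eq_top_iff, Submodule.eq_bot_iff]
    intro x hx
    have hx' := (Submodule.mem_orthogonal' _ _).1 hx
    have hz := aux_zero (x := fun m => (starRingEnd ℂ) (x m)) (C := ‖x‖)
      (fun m => by simpa using lp.norm_apply_le_norm (by norm_num) x m) w hw0 hwt
      (fun n => by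
        have h1 := lp.hasSum_inner (𝕜 := ℂ) x (k n)
        rw [hx' (k n) (Submodule.subset_span ⟨n, rfl⟩)] at h1
        simpa [hk] using h1)
    ext m
    simpa using hz m
  have hlift : ∀ s ∈ S, ∃ g ∈ Submodule.span ℂ T, AnalyticAt ℂ g 0 ∧
      ∀ m, hardyCoeff g m = s m := by
    intro s hs
    induction hs using Submodule.span_induction with
    | mem x hx =>
      obtain ⟨n, rfl⟩ := hx
      set g : ℂ → ℂ := fun z => 1 / (1 - β * ((a:ℂ)^n * z + 1 - (a:ℂ)^n)) with hg
      have hgT : g ∈ T := ⟨n, rfl⟩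
      obtain ⟨h1, h2⟩ := aux_kernel (d n)⁻¹ (w n) (g := g) (Eventually.of_forall fun z => by
        rw [← mul_inv]
        simp only [hg, one_div]
        congr 1
        have : d n * (1 - w n * z) = d n - β * (a:ℂ)^n * z := by
          simp only [hw]
          have := hd0 n
          field_simp
        rw [this]; simp only [hd]; ring)
      refine ⟨d n • g, Submodule.smul_mem _ _ (Submodule.subset_span hgT),
        analyticAt_const.smul h1, fun m => ?_⟩
      rw [aux_smul _ h1, h2, hk, ← mul_assoc, mul_inv_cancel₀ (hd0 n), one_mul]
    | zero =>
      refine ⟨0, Submodule.zero_mem _, analyticAt_const, fun m => ?_⟩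
      exact (aux_coeff (g := 0) (c := fun _ => 0)
        (Eventually.of_forall fun z => by simp)).2 m
    | add x y _ _ hx hy =>
      obtain ⟨g, hg, hg1, hg2⟩ := hx
      obtain ⟨h, hh, hh1, hh2⟩ := hy
      refine ⟨g + h, Submodule.add_mem _ hg hh, hg1.add hh1, fun m => ?_⟩
      rw [aux_add hg1 hh1, hg2, hh2]; rfl
    | smul c x _ hx =>
      obtain ⟨g, hg, hg1, hg2⟩ := hx
      refine ⟨c • g, Submodule.smul_mem _ _ hg, analyticAt_const.smul hg1, fun m => ?_⟩
      rw [aux_smul c hg1, hg2]; rfl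
  have hfm : Memℓp (fun m => hardyCoeff f m : ℕ → ℂ) 2 := by
    apply memℓp_gen
    simpa using hf.2
  let F : lp (fun _ : ℕ => ℂ) 2 := ⟨_, hfm⟩
  have hFc : F ∈ closure (S : Set (lp (fun _ : ℕ => ℂ) 2)) := by
    rw [← Submodule.topologicalClosure_coe, hSd]; trivial
  obtain ⟨s, hs, hdist⟩ := Metric.mem_closure_iff.1 hFc ε hε
  obtain ⟨g, hg, hg1, hg2⟩ := hlift s hs
  refine ⟨g, hg, ?_⟩
  have hfa : AnalyticAt ℂ f 0 := hf.1 0 (by simp)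
  have hn : h2Norm (f - g) = ‖F - s‖ := by
    rw [lp.norm_eq_tsum_rpow (by norm_num)]
    unfold h2Norm
    rw [Real.sqrt_eq_rpow]
    simp only [aux_sub hfa hg1, hg2]
    simp [F]
    rfl
  rw [hn, ← dist_eq_norm]
  exact hdist
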